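/- Let p ∈ [1,∞] and let Y be a Banach space that contains the ℓ_p^n's uniformly: there exists λ ∈ [1,∞) and a sequence of n-dimensional subspaces E_n of Y such that for each n there is a linear isomorphism T_n from ℓ_p^n onto E_n with ‖T_n‖·‖T_n⁻¹‖ ≤ λ. Then every proper subset M of L_p = L_p([0,1]) almost bi-Lipschitzly embeds into Y: there exist a scaling factor r ∈ (0,∞) and a constant D ∈ [1,∞) such that for every continuous function φ : [0,∞) → [0,1) with φ(0) = 0 and φ(t) > 0 for all t > 0, there exists a map f : M → Y satisfying φ(‖x−y‖)·r·‖x−y‖ ≤ ‖f(x) − f(y)‖ ≤ D·r·‖x−y‖ for all x, y ∈ M. -/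

import Mathlib

open MeasureTheory

/-- `X` contains the `ℓ_p^n`'s uniformly: there are `λ ≥ 1` and `n`-dimensional
subspaces `E n` of `X` isomorphic to `ℓ_p^n` with constant at most `λ`. -/
def ContainsLpnUniformly (p : ENNReal) [Fact (1 ≤ p)] (X : Type*)
    [NormedAddCommGroup X] [NormedSpace ℝ X] : Prop :=
  ∃ lam : ℝ, 1 ≤ lam ∧ ∀ n : ℕ, ∃ E : Submodule ℝ X, Module.finrank ℝ E = n ∧
    ∃ T : (PiLp p fun _ : Fin n => ℝ) ≃L[ℝ] E,
      ‖(T : (PiLp p fun _ : Fin n => ℝ) →L[ℝ] E)‖ *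
        ‖(T.symm : E →L[ℝ] (PiLp p fun _ : Fin n => ℝ))‖ ≤ lam

/-- A subset `M` of a normed space is proper if every closed ball of `M`
(in the induced metric) is compact. -/
def IsProperSubset {X : Type*} [NormedAddCommGroup X] (M : Set X) : Prop :=
  ∀ x ∈ M, ∀ r : ℝ, IsCompact {y | y ∈ M ∧ dist y x ≤ r}

/-- `M ⊆ X` almost bi-Lipschitzly embeds into `Y`. -/
def AlmostBiLipEmbedsInto {X : Type*} [NormedAddCommGroup X] (M : Set X)
    (Y : Type*) [NormedAddCommGroup Y] : Prop :=
  ∃ r : ℝ, 0 < r ∧ ∃ D : ℝ, 1 ≤ D ∧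
    ∀ φ : ℝ → ℝ, ContinuousOn φ (Set.Ici 0) → φ 0 = 0 →
      (∀ t, 0 ≤ t → 0 ≤ φ t ∧ φ t < 1) → (∀ t, 0 < t → 0 < φ t) →
      ∃ f : M → Y, ∀ x y : M,
        φ ‖(x : X) - (y : X)‖ * r * ‖(x : X) - (y : X)‖ ≤ ‖f x - f y‖ ∧
        ‖f x - f y‖ ≤ D * r * ‖(x : X) - (y : X)‖

section
variable {p : ENNReal} [Fact (1 ≤ p)] {Y : Type*} [NormedAddCommGroup Y] [NormedSpace ℝ Y]

theorem ContainsLpnUniformly.exists_bounds (hY : ContainsLpnUniformly p Y) :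
    ∃ lam : ℝ, 1 ≤ lam ∧ ∀ n : ℕ, ∃ T : (PiLp p fun _ : Fin n => ℝ) →L[ℝ] Y,
      ∀ a, ‖a‖ ≤ ‖T a‖ ∧ ‖T a‖ ≤ lam * ‖a‖ := by
  obtain ⟨lam, hlam, h⟩ := hY
  refine ⟨lam, hlam, fun n => ?_⟩
  obtain ⟨E, -, T, hT⟩ := h n
  refine ⟨(‖(T.symm : E →L[ℝ] (PiLp p fun _ : Fin n => ℝ))‖ : ℝ) •
    E.subtypeL.comp (T : (PiLp p fun _ : Fin n => ℝ) →L[ℝ] E), fun a => ?_⟩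
  have h1 := (T.symm : E →L[ℝ] (PiLp p fun _ : Fin n => ℝ)).le_opNorm (T a)
  have h2 := (T : (PiLp p fun _ : Fin n => ℝ) →L[ℝ] E).le_opNorm a
  simp only [ContinuousLinearEquiv.coe_coe, ContinuousLinearEquiv.symm_apply_apply] at h1 h2
  have h3 : ∀ c : ℝ, 0 ≤ c → ‖(c • E.subtypeL.comp
      (T : (PiLp p fun _ : Fin n => ℝ) →L[ℝ] E)) a‖ = c * ‖T a‖ := fun c hc => by
    simp [norm_smul, abs_of_nonneg hc]
  refine ⟨h1.trans_eq (h3 _ (norm_nonneg T.symm.toContinuousLinearMap)).symm,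
    (h3 _ (norm_nonneg T.symm.toContinuousLinearMap)).trans_le ?_⟩
  calc _ ≤ ‖(T.symm : E →L[ℝ] (PiLp p fun _ : Fin n => ℝ))‖ *
        (‖(T : (PiLp p fun _ : Fin n => ℝ) →L[ℝ] E)‖ * ‖a‖) := by gcongr
    _ = (‖(T : (PiLp p fun _ : Fin n => ℝ) →L[ℝ] E)‖ *
        ‖(T.symm : E →L[ℝ] (PiLp p fun _ : Fin n => ℝ))‖) * ‖a‖ := by ring
    _ ≤ lam * ‖a‖ := by gcongr

/-- Spreading each coordinate along a unit vector is isometric on `ℓ_p` sums. -/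
theorem PiLp.norm_toLp_prod_mul {ι κ : Type*} [Fintype ι] [Fintype κ]
    (v : ι → PiLp p fun _ : κ => ℝ) (hv : ∀ i, ‖v i‖ = 1) (a : PiLp p fun _ : ι => ℝ) :
    ‖(WithLp.toLp p fun x : ι × κ => a x.1 * v x.1 x.2 : PiLp p fun _ : ι × κ => ℝ)‖ = ‖a‖ := by
  have hp : 1 ≤ p := Fact.out
  rcases eq_or_ne p ⊤ with rfl | hpt
  · simp only [PiLp.norm_eq_ciSup] at hv ⊢
    simp only [norm_mul]
    refine le_antisymm (Real.iSup_le (fun x => ?_) (Real.iSup_nonneg fun _ => norm_nonneg _))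
      (Real.iSup_le (fun i => ?_) (Real.iSup_nonneg fun _ => by positivity))
    · have h1 : ‖v x.1 x.2‖ ≤ 1 :=
        (le_ciSup (f := fun i => ‖v x.1 i‖) (Set.finite_range _).bddAbove x.2).trans (hv x.1).le
      have h2 : ‖a x.1‖ ≤ ⨆ i, ‖a i‖ :=
        le_ciSup (f := fun i => ‖a i‖) (Set.finite_range _).bddAbove x.1
      calc _ ≤ ‖a x.1‖ * 1 := by gcongr
        _ ≤ _ := by simpa using h2
    · rw [← mul_one ‖a i‖, ← hv i, Real.mul_iSup_of_nonneg (norm_nonneg _)]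
      refine Real.iSup_le (fun s => ?_) (Real.iSup_nonneg fun _ => by positivity)
      exact le_ciSup (f := fun x : ι × κ => ‖a x.1‖ * ‖v x.1 x.2‖)
        (Set.finite_range _).bddAbove (i, s)
  · have hp0 : 0 < p.toReal := ENNReal.toReal_pos (by positivity) hpt
    have hv' : ∀ i, ∑ s, ‖v i s‖ ^ p.toReal = 1 := fun i => by
      have := hv i
      rw [PiLp.norm_eq_sum hp0] at this
      rw [← Real.one_rpow p.toReal, ← this,
        ← Real.rpow_mul (Finset.sum_nonneg fun _ _ => by positivity),
        one_div_mul_cancel hp0.ne', Real.rpow_one]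
    rw [PiLp.norm_eq_sum hp0, PiLp.norm_eq_sum hp0, Fintype.sum_prod_type]
    simp only [norm_mul, Real.mul_rpow (norm_nonneg _) (norm_nonneg _), ← Finset.mul_sum, hv',
      mul_one]

/-- Inside the kernel of finitely many functionals one finds `ℓ_p^n` with the same constant. -/
theorem exists_bounds_of_vanishing {lam : ℝ}
    (h : ∀ n : ℕ, ∃ T : (PiLp p fun _ : Fin n => ℝ) →L[ℝ] Y,
      ∀ a, ‖a‖ ≤ ‖T a‖ ∧ ‖T a‖ ≤ lam * ‖a‖)
    (Φ : Finset (Y →L[ℝ] ℝ)) (n : ℕ) :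
    ∃ T : (PiLp p fun _ : Fin n => ℝ) →L[ℝ] Y,
      (∀ a, ‖a‖ ≤ ‖T a‖ ∧ ‖T a‖ ≤ lam * ‖a‖) ∧ ∀ ψ ∈ Φ, ∀ a, ψ (T a) = 0 := by
  classical
  let m := Φ.card + 1
  obtain ⟨T, hT⟩ := h (n * m)
  let R : (PiLp p fun _ : Fin n × Fin m => ℝ) ≃ₗᵢ[ℝ] (PiLp p fun _ : Fin (n * m) => ℝ) :=
    LinearIsometryEquiv.piLpCongrLeft p ℝ ℝ finProdFinEquiv
  let S : (Fin n × Fin m → ℝ) →ₗ[ℝ] Y := T.toLinearMap ∘ₗ R.toLinearEquiv.toLinearMap ∘ₗ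
    (WithLp.linearEquiv p ℝ (Fin n × Fin m → ℝ)).symm.toLinearMap
  let ins (i : Fin n) : (Fin m → ℝ) →ₗ[ℝ] (Fin n × Fin m → ℝ) :=
    LinearMap.pi fun x => if x.1 = i then LinearMap.proj x.2 else 0
  let ev : Y →ₗ[ℝ] (Φ → ℝ) := LinearMap.pi fun ψ => (ψ : Y →L[ℝ] ℝ).toLinearMap
  have hker : ∀ i, ∃ v : PiLp p fun _ : Fin m => ℝ, ‖v‖ = 1 ∧ ev (S (ins i v.ofLp)) = 0 := by
    intro i
    have : LinearMap.ker (ev ∘ₗ S ∘ₗ ins i) ≠ ⊥ :=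
      LinearMap.ker_ne_bot_of_finrank_lt (by simp [m])
    obtain ⟨w, hw, hw0⟩ := (Submodule.ne_bot_iff _).1 this
    have hw0' : WithLp.toLp p w ≠ 0 := by simpa using hw0
    refine ⟨‖WithLp.toLp p w‖⁻¹ • WithLp.toLp p w, ?_, ?_⟩
    · rw [norm_smul, norm_inv, norm_norm, inv_mul_cancel₀ (norm_ne_zero_iff.2 hw0')]
    have : ev (S (ins i w)) = 0 := hw
    rw [WithLp.ofLp_smul, map_smul, map_smul, map_smul, this, smul_zero]
  choose v hv hv0 using hker
  let B : (PiLp p fun _ : Fin n => ℝ) →ₗ[ℝ] (Fin n × Fin m → ℝ) :=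
    { toFun := fun a x => a x.1 * v x.1 x.2
      map_add' := fun a b => by ext x; simp [add_mul]
      map_smul' := fun c a => by ext x; simp [mul_assoc] }
  have hB : ∀ a, B a = ∑ i, a i • ins i (v i).ofLp := fun a => by
    ext x
    simp only [B, ins, LinearMap.coe_mk, AddHom.coe_mk, Finset.sum_apply, Pi.smul_apply,
      LinearMap.pi_apply, smul_eq_mul]
    rw [Finset.sum_eq_single x.1]
    · simp
    · intro b _ hb
      simp [hb.symm]
    · simp
  refine ⟨LinearMap.toContinuousLinearMap (S ∘ₗ B), fun a => ?_, fun ψ hψ a => ?_⟩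
  · have h1 := hT (R (WithLp.toLp p (B a)))
    have h2 : ‖R (WithLp.toLp p (B a))‖ = ‖a‖ := by
      rw [LinearIsometryEquiv.norm_map]
      exact PiLp.norm_toLp_prod_mul v hv a
    rw [h2] at h1
    exact h1
  · have : ev (S (B a)) = 0 := by
      simp only [hB, map_sum, map_smul, hv0, smul_zero, Finset.sum_const_zero]
    exact congrFun this ⟨ψ, hψ⟩

/-- A finite-dimensional subspace is normed up to a factor `2` by finitely many functionals. -/
theorem Submodule.exists_finset_norming (G : Submodule ℝ Y) [FiniteDimensional ℝ G] :
    ∃ Φ : Finset (Y →L[ℝ] ℝ), (∀ ψ ∈ Φ, ‖ψ‖ ≤ 1) ∧ ∀ g ∈ G, ∃ ψ ∈ Φ, ‖g‖ ≤ 2 * ‖ψ g‖ := by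
  classical
  have hd : ∀ g : G, ∃ ψ : Y →L[ℝ] ℝ, ‖ψ‖ ≤ 1 ∧ ψ g = ‖(g : Y)‖ :=
    fun g => exists_dual_vector'' ℝ (g : Y)
  choose ψ hψ1 hψ2 using hd
  obtain ⟨t, -, ht⟩ := (isCompact_sphere (0 : G) 1).elim_nhds_subcover
    (fun g => {h : G | 1 / 2 < ψ g h}) (fun g hg => by
      refine (isOpen_lt continuous_const ((ψ g).continuous.comp continuous_subtype_val)).mem_nhds ?_
      have : ‖(g : Y)‖ = 1 := by simpa using hg
      simp only [Set.mem_ofPred_eq, Function.comp, hψ2, this]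
      norm_num)
  refine ⟨insert 0 (t.image ψ), fun χ hχ => ?_, fun g hg => ?_⟩
  · rcases Finset.mem_insert.1 hχ with rfl | h
    · simp
    · obtain ⟨g, -, rfl⟩ := Finset.mem_image.1 h
      exact hψ1 g
  rcases eq_or_ne g 0 with rfl | hg0
  · exact ⟨0, by simp⟩
  have hpos : 0 < ‖g‖ := norm_pos_iff.2 hg0
  have hs : (‖g‖⁻¹ • ⟨g, hg⟩ : G) ∈ Metric.sphere (0 : G) 1 := by
    simp [norm_smul, hpos.ne']
  obtain ⟨h, hh, hlt⟩ := Set.mem_iUnion₂.1 (ht hs)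
  refine ⟨ψ h, Finset.mem_insert_of_mem (Finset.mem_image_of_mem _ hh), ?_⟩
  simp only [Set.mem_ofPred_eq, Submodule.coe_smul, map_smul, smul_eq_mul] at hlt
  rw [inv_mul_eq_div, div_lt_div_iff₀ two_pos hpos] at hlt
  have := le_abs_self (ψ h g)
  rw [Real.norm_eq_abs]
  linarith
/-- Copies of `ℓ_p^n` in prescribed dimensions whose sum is almost direct. -/
theorem ContainsLpnUniformly.exists_almost_direct_sum (hY : ContainsLpnUniformly p Y) :
    ∃ lam : ℝ, 1 ≤ lam ∧ ∀ N : ℕ → ℕ, ∃ T : ∀ n, (PiLp p fun _ : Fin (N n) => ℝ) →L[ℝ] Y,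
      (∀ n a, ‖T n a‖ ≤ lam * ‖a‖) ∧
      ∀ (a : ∀ n, PiLp p fun _ : Fin (N n) => ℝ) (y : Y), HasSum (fun n => T n (a n)) y →
        ∀ n, ‖a n‖ ≤ 4 * ‖y‖ := by
  classical
  obtain ⟨lam, hlam, h⟩ := hY.exists_bounds
  refine ⟨lam, hlam, fun N => ?_⟩
  choose T hT hT0 using exists_bounds_of_vanishing h
  have hnf : ∀ G : Submodule ℝ Y, ∃ Φ : Finset (Y →L[ℝ] ℝ), FiniteDimensional ℝ G →
      (∀ ψ ∈ Φ, ‖ψ‖ ≤ 1) ∧ ∀ g ∈ G, ∃ ψ ∈ Φ, ‖g‖ ≤ 2 * ‖ψ g‖ := fun G => by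
    by_cases hG : FiniteDimensional ℝ G
    · obtain ⟨Φ, hΦ⟩ := G.exists_finset_norming
      exact ⟨Φ, fun _ => hΦ⟩
    · exact ⟨∅, fun h => absurd h hG⟩
  choose nf hnf using hnf
  let st : ℕ → Finset (Y →L[ℝ] ℝ) × Submodule ℝ Y := fun n => Nat.rec (nf ⊥, ⊥) (fun n s =>
    (s.1 ∪ nf (s.2 ⊔ (T s.1 (N n)).range),
      s.2 ⊔ (T s.1 (N n)).range)) n
  have hfd : ∀ n, FiniteDimensional ℝ (st n).2 := fun n => by
    induction n with
    | zero => exact inferInstanceAs (FiniteDimensional ℝ (⊥ : Submodule ℝ Y))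
    | succ n ih =>
      exact inferInstanceAs (FiniteDimensional ℝ
        ((st n).2 ⊔ (T (st n).1 (N n)).range : Submodule ℝ Y))
  have hnorming : ∀ n, nf (st n).2 ⊆ (st n).1 := fun n => by
    cases n with
    | zero => exact subset_rfl
    | succ n => exact Finset.subset_union_right
  have hmono : Monotone fun n => (st n).1 :=
    monotone_nat_of_le_succ fun n => Finset.subset_union_left
  refine ⟨fun n => T (st n).1 (N n), fun n a => (hT _ _ a).2, fun a y hy => ?_⟩
  have hmem : ∀ n, ∑ i ∈ Finset.range n, T (st i).1 (N i) (a i) ∈ (st n).2 := fun n => by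
    induction n with
    | zero => simp
    | succ n ih =>
      rw [Finset.sum_range_succ]
      exact Submodule.add_mem_sup ih ⟨_, rfl⟩
  have hpartial : ∀ n, ‖∑ i ∈ Finset.range n, T (st i).1 (N i) (a i)‖ ≤ 2 * ‖y‖ := fun n => by
    obtain ⟨hle, hex⟩ := hnf _ (hfd n)
    obtain ⟨ψ, hψ, hψn⟩ := hex _ (hmem n)
    have h1 : HasSum (fun i => ψ (T (st i).1 (N i) (a i)))
        (∑ i ∈ Finset.range n, ψ (T (st i).1 (N i) (a i))) :=
      hasSum_sum_of_ne_finset_zero fun i hi =>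
        hT0 _ _ ψ (hmono (by simpa using hi) (hnorming n hψ)) _
    rw [map_sum, h1.unique (ψ.hasSum hy)] at hψn
    have h2 := ψ.le_of_opNorm_le (hle ψ hψ) y
    linarith
  intro n
  calc ‖a n‖ ≤ ‖T (st n).1 (N n) (a n)‖ := (hT _ _ _).1
    _ = ‖∑ i ∈ Finset.range (n + 1), T (st i).1 (N i) (a i) -
        ∑ i ∈ Finset.range n, T (st i).1 (N i) (a i)‖ := by
      rw [Finset.sum_range_succ, add_sub_cancel_left]
    _ ≤ 2 * ‖y‖ + 2 * ‖y‖ := norm_sub_le_of_le (hpartial _) (hpartial _)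
    _ = 4 * ‖y‖ := by ring
end

section
variable {α : Type*} [MeasurableSpace α] {μ : Measure α} {p : ENNReal}

theorem norm_toLp_eLpNorm_restrict [Fact (1 ≤ p)] {ι : Type*} [Fintype ι] {A : ι → Set α}
    (hA : ∀ i, MeasurableSet (A i)) (hd : Pairwise (Function.onFun Disjoint A))
    (hU : ⋃ i, A i = Set.univ) {u : α → ℝ} (hu : MemLp u p μ) :
    ‖(WithLp.toLp p fun i => (eLpNorm u p (μ.restrict (A i))).toReal : PiLp p fun _ : ι => ℝ)‖ =
      (eLpNorm u p μ).toReal := by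
  have hp : 1 ≤ p := Fact.out
  have hfin : ∀ i, eLpNorm u p (μ.restrict (A i)) ≠ ⊤ := fun i => (hu.restrict _).2.ne
  rcases eq_or_ne p ⊤ with rfl | hpt
  · simp only [PiLp.norm_eq_ciSup, Real.norm_eq_abs, ENNReal.abs_toReal]
    refine le_antisymm (Real.iSup_le (fun i => ?_) ENNReal.toReal_nonneg) ?_
    · exact ENNReal.toReal_mono hu.2.ne (eLpNorm_mono_measure _ Measure.restrict_le_self)
    · refine ENNReal.toReal_le_of_le_ofReal (Real.iSup_nonneg fun _ => ENNReal.toReal_nonneg) ?_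
      rw [eLpNorm_exponent_top]
      refine eLpNormEssSup_le_of_ae_bound ?_
      suffices h : ∀ᵐ x ∂μ.restrict (⋃ i, A i),
          ‖u x‖ ≤ ⨆ i, (eLpNorm u ⊤ (μ.restrict (A i))).toReal by
        rwa [hU, Measure.restrict_univ] at h
      refine (ae_restrict_iUnion_iff _ _).2 fun i => ?_
      filter_upwards [ae_le_eLpNormEssSup (f := u) (μ := μ.restrict (A i))] with x hx
      rw [← eLpNorm_exponent_top] at hx
      have h1 := ENNReal.toReal_mono (hfin i) hx
      rw [toReal_enorm] at h1
      exact h1.trans (le_ciSup (f := fun i => (eLpNorm u ⊤ (μ.restrict (A i))).toReal)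
        (Set.finite_range _).bddAbove i)
  · have hp0 : 0 < p.toReal := ENNReal.toReal_pos (by positivity) hpt
    have hp0' : p ≠ 0 := by positivity
    have hpow : ∀ ν : Measure α, (eLpNorm u p ν) ^ p.toReal = ∫⁻ x, ‖u x‖ₑ ^ p.toReal ∂ν :=
      fun ν => by
        rw [eLpNorm_eq_lintegral_rpow_enorm_toReal hp0' hpt, ← ENNReal.rpow_mul,
          one_div_mul_cancel hp0.ne', ENNReal.rpow_one]
    rw [PiLp.norm_eq_sum hp0]
    simp only [Real.norm_eq_abs, ENNReal.abs_toReal, ENNReal.toReal_rpow, hpow]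
    rw [← ENNReal.toReal_sum fun i _ => by
        rw [← hpow]; exact ENNReal.rpow_ne_top_of_nonneg hp0.le (hfin i),
      ← tsum_fintype (L := .unconditional ι), ← lintegral_iUnion hA hd, hU, Measure.restrict_univ,
      ← hpow,
      ← ENNReal.toReal_rpow, ← Real.rpow_mul ENNReal.toReal_nonneg, mul_one_div_cancel hp0.ne',
      Real.rpow_one]

theorem abs_setIntegral_le_eLpNorm_restrict [IsFiniteMeasure μ] (hp : 1 ≤ p) (A : Set α)
    {u : α → ℝ} (hu : MemLp u p μ) :
    |μ.real A ^ (1 / p.toReal - 1) * ∫ x in A, u x ∂μ| ≤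
      (eLpNorm u p (μ.restrict A)).toReal := by
  rcases eq_or_ne (μ A) 0 with h0 | h0
  · simp [Measure.restrict_eq_zero.2 h0]
  have hpos : 0 < μ.real A := ENNReal.toReal_pos h0 (measure_ne_top _ _)
  have hu' := hu.restrict A
  have h1 : |∫ x in A, u x ∂μ| ≤ (eLpNorm u 1 (μ.restrict A)).toReal := by
    rw [eLpNorm_one_eq_lintegral_enorm]
    rw [← Real.norm_eq_abs]
    simpa only [ofReal_norm] using norm_integral_le_lintegral_norm (μ := μ.restrict A) u
  have h2 : (eLpNorm u 1 (μ.restrict A)).toReal ≤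
      (eLpNorm u p (μ.restrict A)).toReal * μ.real A ^ (1 - 1 / p.toReal) := by
    have h := eLpNorm_le_eLpNorm_mul_rpow_measure_univ hp hu'.1
    rw [Measure.restrict_apply_univ, ENNReal.toReal_one, div_one] at h
    have h' := ENNReal.toReal_mono (ENNReal.mul_ne_top hu'.2.ne
      (by simp [ENNReal.rpow_eq_top_iff, h0])) h
    rwa [ENNReal.toReal_mul, ← ENNReal.toReal_rpow] at h'
  rw [abs_mul, abs_of_nonneg (by positivity)]
  calc _ ≤ μ.real A ^ (1 / p.toReal - 1) *
        ((eLpNorm u p (μ.restrict A)).toReal * μ.real A ^ (1 - 1 / p.toReal)) := by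
        gcongr; exact h1.trans h2
    _ = (eLpNorm u p (μ.restrict A)).toReal *
        μ.real A ^ ((1 / p.toReal - 1) + (1 - 1 / p.toReal)) := by
      rw [Real.rpow_add hpos]; ring
    _ = _ := by simp

theorem abs_setIntegral_eq_eLpNorm_restrict [IsFiniteMeasure μ] (hp : 1 ≤ p) (A : Set α)
    {u : α → ℝ} {c : ℝ} (hc : u =ᵐ[μ.restrict A] fun _ => c) :
    |μ.real A ^ (1 / p.toReal - 1) * ∫ x in A, u x ∂μ| =
      (eLpNorm u p (μ.restrict A)).toReal := by
  rcases eq_or_ne (μ A) 0 with h0 | h0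
  · simp [Measure.restrict_eq_zero.2 h0]
  have hpos : 0 < μ.real A := ENNReal.toReal_pos h0 (measure_ne_top _ _)
  rw [integral_congr_ae hc, eLpNorm_congr_ae hc, eLpNorm_const _ (by positivity)
    (by simpa using h0), setIntegral_const, smul_eq_mul, ← mul_assoc, abs_mul,
    ENNReal.toReal_mul, Measure.restrict_apply_univ, ← ENNReal.toReal_rpow, toReal_enorm,
    abs_of_nonneg (by positivity), ← Measure.real, Real.norm_eq_abs, mul_comm,
    ← Real.rpow_add_one hpos.ne', sub_add_cancel]

theorem PiLp.norm_le_of_abs_le [Fact (1 ≤ p)] {ι : Type*} [Fintype ι]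
    {a b : PiLp p fun _ : ι => ℝ} (h : ∀ i, |a i| ≤ |b i|) : ‖a‖ ≤ ‖b‖ := by
  have hp : 1 ≤ p := Fact.out
  rcases eq_or_ne p ⊤ with rfl | hpt
  · simp only [PiLp.norm_eq_ciSup]
    exact Real.iSup_le (fun i => (h i).trans (le_ciSup (f := fun i => ‖b i‖)
      (Set.finite_range _).bddAbove i)) (Real.iSup_nonneg fun _ => norm_nonneg _)
  · have hp0 : 0 < p.toReal := ENNReal.toReal_pos (by positivity) hpt
    rw [PiLp.norm_eq_sum hp0, PiLp.norm_eq_sum hp0]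
    simp only [Real.norm_eq_abs]
    exact Real.rpow_le_rpow (Finset.sum_nonneg fun _ _ => by positivity)
      (Finset.sum_le_sum fun i _ => Real.rpow_le_rpow (abs_nonneg _) (h i) hp0.le) (by positivity)

/-- Averaging over a finite partition, as a contraction into `ℓ_p`. -/
theorem exists_averaging [IsFiniteMeasure μ] [Fact (1 ≤ p)] {ι : Type*} [Fintype ι]
    {A : ι → Set α} (hA : ∀ i, MeasurableSet (A i)) (hd : Pairwise (Function.onFun Disjoint A))
    (hU : ⋃ i, A i = Set.univ) :
    ∃ P : Lp ℝ p μ →L[ℝ] PiLp p fun _ : ι => ℝ, (∀ u, ‖P u‖ ≤ ‖u‖) ∧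
      ∀ u : Lp ℝ p μ, (∀ i, ∃ c : ℝ, u =ᵐ[μ.restrict (A i)] fun _ => c) → ‖u‖ ≤ ‖P u‖ := by
  have hp : 1 ≤ p := Fact.out
  have hint : ∀ (u : Lp ℝ p μ) i, IntegrableOn u (A i) μ := fun u i =>
    ((Lp.memLp u).integrable hp).integrableOn
  let Q : Lp ℝ p μ →ₗ[ℝ] PiLp p fun _ : ι => ℝ :=
    { toFun := fun u => WithLp.toLp p fun i =>
        μ.real (A i) ^ (1 / p.toReal - 1) * ∫ x in A i, u x ∂μ
      map_add' := fun u v => by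
        ext i
        simp only [PiLp.add_apply]
        rw [integral_congr_ae (ae_restrict_of_ae (Lp.coeFn_add u v)), ← mul_add]
        simp only [Pi.add_apply]
        rw [integral_add (hint u i) (hint v i)]
      map_smul' := fun c u => by
        ext i
        simp only [PiLp.smul_apply, RingHom.id_apply, smul_eq_mul]
        rw [integral_congr_ae (ae_restrict_of_ae (Lp.coeFn_smul c u))]
        simp only [Pi.smul_apply, smul_eq_mul]
        rw [integral_const_mul]
        ring }
  have hQ : ∀ u i, Q u i = μ.real (A i) ^ (1 / p.toReal - 1) * ∫ x in A i, u x ∂μ :=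
    fun _ _ => rfl
  have hle : ∀ u, ‖Q u‖ ≤ ‖u‖ := fun u => by
    rw [Lp.norm_def, ← norm_toLp_eLpNorm_restrict hA hd hU (Lp.memLp u)]
    refine PiLp.norm_le_of_abs_le fun i => ?_
    rw [hQ, ENNReal.abs_toReal]
    exact abs_setIntegral_le_eLpNorm_restrict hp _ (Lp.memLp u)
  refine ⟨Q.mkContinuous 1 fun u => by simpa using hle u, hle, fun u hu => ?_⟩
  rw [Lp.norm_def, ← norm_toLp_eLpNorm_restrict hA hd hU (Lp.memLp u)]
  refine PiLp.norm_le_of_abs_le fun i => ?_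
  obtain ⟨c, hc⟩ := hu i
  rw [ENNReal.abs_toReal]
  exact (abs_setIntegral_eq_eLpNorm_restrict hp _ hc).ge

theorem exists_simpleFunc_norm_sub_lt [IsFiniteMeasure μ] [Fact (1 ≤ p)] (u : Lp ℝ p μ) {ε : ℝ}
    (hε : 0 < ε) : ∃ (s : SimpleFunc α ℝ) (hs : MemLp s p μ), ‖u - hs.toLp s‖ < ε := by
  rcases eq_or_ne p ⊤ with rfl | hpt
  · let δ : ℝ := ε / 2
    have hδ : 0 < δ := by positivity
    let g : α → ℝ := (Lp.aestronglyMeasurable u).aemeasurable.mk u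
    have hg : Measurable g := (Lp.aestronglyMeasurable u).aemeasurable.measurable_mk
    have hug : u =ᵐ[μ] g := (Lp.aestronglyMeasurable u).aemeasurable.ae_eq_mk
    let h : α → ℤ := fun x => ⌊max (-‖u‖) (min ‖u‖ (g x)) / δ⌋
    have hh : Measurable h :=
      Int.measurable_floor.comp ((measurable_const.max (measurable_const.min hg)).div_const δ)
    have hfin : (Set.range h).Finite := by
      refine (Set.finite_Icc ⌊-‖u‖ / δ⌋ ⌊‖u‖ / δ⌋).subset ?_
      rintro _ ⟨x, rfl⟩
      have hn := norm_nonneg u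
      refine ⟨Int.floor_mono ?_, Int.floor_mono ?_⟩
      · gcongr; exact le_max_left _ _
      · gcongr; exact max_le (by linarith) (min_le_left _ _)
    let s : SimpleFunc α ℝ := SimpleFunc.map (fun n : ℤ => n * δ)
      ⟨h, fun n => hh (measurableSet_singleton n), hfin⟩
    have hs : MemLp s ⊤ μ := s.memLp_of_isFiniteMeasure ⊤ μ
    refine ⟨s, hs, ?_⟩
    refine lt_of_le_of_lt ?_ (half_lt_self hε)
    have hbound : ∀ᵐ x ∂μ, ‖(u - hs.toLp s) x‖ ≤ δ := by
      filter_upwards [Lp.coeFn_sub u (hs.toLp s), hs.coeFn_toLp, hug,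
        ae_le_eLpNormEssSup (f := u) (μ := μ)] with x h1 h2 h3 h4
      rw [← eLpNorm_exponent_top] at h4
      have h5 := ENNReal.toReal_mono (Lp.eLpNorm_ne_top u) h4
      rw [toReal_enorm, ← Lp.norm_def, Real.norm_eq_abs, abs_le] at h5
      have h6 : s x = h x * δ := rfl
      have h7 : h x = ⌊u x / δ⌋ := by
        simp only [h, ← h3, min_eq_right h5.2, max_eq_right h5.1]
      have h8 := Int.floor_le (u x / δ)
      have h9 := Int.lt_floor_add_one (u x / δ)
      rw [le_div_iff₀ hδ] at h8
      rw [div_lt_iff₀ hδ] at h9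
      rw [h1, Pi.sub_apply, h2, h6, h7, Real.norm_eq_abs, abs_le]
      constructor <;> linarith
    simpa using Lp.norm_le_of_ae_bound hδ.le hbound
  · obtain ⟨s, hs, hsm⟩ := (Lp.memLp u).exists_simpleFunc_eLpNorm_sub_lt hpt
      (ENNReal.ofReal_pos.2 hε).ne'
    refine ⟨s, hsm, ?_⟩
    rw [Lp.norm_def, eLpNorm_congr_ae ((Lp.coeFn_sub _ _).trans
      (Filter.EventuallyEq.rfl.sub hsm.coeFn_toLp))]
    exact ENNReal.toReal_lt_of_lt_ofReal hs

/-- Finitely many simple functions are measurable with respect to a common finite partition. -/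
theorem exists_partition_of_simpleFunc {κ : Type*} [Finite κ] (s : κ → SimpleFunc α ℝ) :
    ∃ (n : ℕ) (A : Fin n → Set α), (∀ i, MeasurableSet (A i)) ∧
      Pairwise (Function.onFun Disjoint A) ∧ ⋃ i, A i = Set.univ ∧
      ∀ k i, ∃ c : ℝ, ∀ x ∈ A i, s k x = c := by
  let S : α → κ → ℝ := fun x k => s k x
  have hfin : (Set.range S).Finite := by
    refine (Set.Finite.pi fun k => (s k).finite_range).subset ?_
    rintro _ ⟨x, rfl⟩ k -
    exact ⟨x, rfl⟩
  have := hfin.fintype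
  let e := Fintype.equivFin (Set.range S)
  refine ⟨Fintype.card (Set.range S), fun i => S ⁻¹' {(e.symm i : κ → ℝ)}, fun i => ?_, ?_, ?_, ?_⟩
  · have hS : Measurable S := measurable_pi_lambda _ fun k => (s k).measurable
    have : Countable κ := inferInstance
    exact hS (measurableSet_singleton _)
  · intro i j hij
    refine Set.disjoint_left.2 fun x hx hx' => hij (e.symm.injective (Subtype.ext ?_))
    exact Eq.trans (Eq.symm hx) hx'
  · refine Set.eq_univ_of_forall fun x => Set.mem_iUnion.2 ⟨e ⟨S x, x, rfl⟩, ?_⟩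
    simp
  · exact fun k i => ⟨(e.symm i : κ → ℝ) k, fun x hx => congrFun hx k⟩

/-- On a compact subset of `L_p` the norm is computed up to `ε` by a contraction into `ℓ_p^n`. -/
theorem IsCompact.exists_almost_isometry_PiLp [IsFiniteMeasure μ] [Fact (1 ≤ p)]
    {K : Set (Lp ℝ p μ)} (hK : IsCompact K) {ε : ℝ} (hε : 0 < ε) :
    ∃ (n : ℕ) (P : Lp ℝ p μ →L[ℝ] PiLp p fun _ : Fin n => ℝ), (∀ u, ‖P u‖ ≤ ‖u‖) ∧
      ∀ u ∈ K, ‖u‖ - ε ≤ ‖P u‖ := by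
  obtain ⟨t, -, htf, ht⟩ := hK.finite_cover_balls (half_pos (half_pos hε))
  have := htf.to_subtype
  choose s hs hst using fun u : t =>
    exists_simpleFunc_norm_sub_lt (μ := μ) (p := p) u.1 (half_pos (half_pos hε))
  obtain ⟨n, A, hA, hd, hU, hc⟩ := exists_partition_of_simpleFunc s
  obtain ⟨P, hP, hP'⟩ := exists_averaging (μ := μ) (p := p) hA hd hU
  refine ⟨n, P, hP, fun u hu => ?_⟩
  obtain ⟨v, hv, huv⟩ := Set.mem_iUnion₂.1 (ht hu)
  rw [mem_ball_iff_norm] at huv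
  have h1 := hP' ((hs ⟨v, hv⟩).toLp _) fun i => by
    obtain ⟨c, hc⟩ := hc ⟨v, hv⟩ i
    refine ⟨c, ?_⟩
    filter_upwards [ae_restrict_of_ae (hs ⟨v, hv⟩).coeFn_toLp, ae_restrict_mem (hA i)] with x hx hx'
    rw [hx, hc x hx']
  have h2 := hst ⟨v, hv⟩
  set w := (hs ⟨v, hv⟩).toLp _
  have h3 : ‖u - w‖ ≤ ε / 2 := by
    calc ‖u - w‖ = ‖(u - v) + (v - w)‖ := by abel_nf
      _ ≤ ‖u - v‖ + ‖v - w‖ := norm_add_le _ _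
      _ ≤ ε / 2 / 2 + ε / 2 / 2 := by gcongr
      _ = ε / 2 := by ring
  have h4 := norm_sub_norm_le u w
  have h5 := norm_sub_norm_le (P w) (P u)
  have h6 := hP (u - w)
  rw [map_sub, ← norm_sub_rev] at h6
  linarith
end

section
variable {E : Type*} [NormedAddCommGroup E] [NormedSpace ℝ E]

/-- The identity on the ball of radius `R`, cut off radially to vanish outside radius `2 * R`. -/
noncomputable def radialCutoff (R : ℝ) (x : E) : E := max 0 (min 1 (2 - ‖x‖ / R)) • x

theorem radialCutoff_of_le {R : ℝ} (hR : 0 < R) {x : E} (hx : ‖x‖ ≤ R) : radialCutoff R x = x := by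
  have : ‖x‖ / R ≤ 1 := (div_le_one hR).2 hx
  rw [radialCutoff, min_eq_left (by linarith), max_eq_right zero_le_one, one_smul]

theorem radialCutoff_of_ge {R : ℝ} (hR : 0 < R) {x : E} (hx : 2 * R ≤ ‖x‖) :
    radialCutoff R x = 0 := by
  have : 2 ≤ ‖x‖ / R := (le_div_iff₀ hR).2 hx
  rw [radialCutoff, max_eq_left ((min_le_right _ _).trans (by linarith)), zero_smul]

theorem norm_radialCutoff_sub_le {R : ℝ} (hR : 0 < R) (x y : E) :
    ‖radialCutoff R x - radialCutoff R y‖ ≤ 3 * ‖x - y‖ := by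
  wlog hxy : ‖y‖ ≤ ‖x‖ generalizing x y
  · rw [norm_sub_rev, norm_sub_rev x]
    exact this y x (le_of_not_ge hxy)
  rcases le_total (2 * R) ‖y‖ with hy | hy
  · rw [radialCutoff_of_ge hR hy, radialCutoff_of_ge hR (hy.trans hxy), sub_zero, norm_zero]
    positivity
  set a := max 0 (min 1 (2 - ‖x‖ / R)) with ha
  set b := max 0 (min 1 (2 - ‖y‖ / R)) with hb
  have ha0 : 0 ≤ a := le_max_left _ _
  have ha1 : a ≤ 1 := max_le zero_le_one (min_le_left _ _)
  have hab : |a - b| ≤ ‖x - y‖ / R := by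
    calc |a - b| ≤ |min 1 (2 - ‖x‖ / R) - min 1 (2 - ‖y‖ / R)| := by
          simpa using abs_max_sub_max_le_max 0 (min 1 (2 - ‖x‖ / R)) 0 (min 1 (2 - ‖y‖ / R))
      _ ≤ |(2 - ‖x‖ / R) - (2 - ‖y‖ / R)| := by
          simpa using abs_min_sub_min_le_max 1 (2 - ‖x‖ / R) 1 (2 - ‖y‖ / R)
      _ = |‖x‖ - ‖y‖| / R := by
          rw [← abs_neg, ← abs_of_pos hR, ← abs_div, abs_of_pos hR]; ring_nf
      _ ≤ ‖x - y‖ / R := by gcongr; exact abs_norm_sub_norm_le x y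
  calc ‖radialCutoff R x - radialCutoff R y‖ = ‖a • (x - y) + (a - b) • y‖ := by
        rw [radialCutoff, radialCutoff, ← ha, ← hb, smul_sub, sub_smul]; abel_nf
    _ ≤ a * ‖x - y‖ + |a - b| * ‖y‖ := by
        refine (norm_add_le _ _).trans_eq ?_
        rw [norm_smul, norm_smul, Real.norm_of_nonneg ha0, Real.norm_eq_abs]
    _ ≤ 1 * ‖x - y‖ + ‖x - y‖ / R * (2 * R) := by gcongr
    _ = 3 * ‖x - y‖ := by field_simp; ring

/-- The identity as a sum of Lipschitz maps supported on dyadic annuli. -/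
theorem exists_dyadic_decomposition (E : Type*) [NormedAddCommGroup E] [NormedSpace ℝ E] :
    ∃ V : ℕ → E → E, (∀ k x y, ‖V k x - V k y‖ ≤ 6 * ‖x - y‖) ∧ (∀ x, HasSum (fun k => V k x) x) ∧
      (∀ x, ∃ s : Finset ℕ, s.card ≤ 2 ∧ ∀ k ∉ s, V k x = 0) ∧
      ∀ k, ∃ R : ℝ, ∀ x, R < ‖x‖ → V k x = 0 := by
  let W : ℕ → E → E := fun k => radialCutoff (2 ^ k)
  have hpos : ∀ k : ℕ, (0 : ℝ) < 2 ^ k := fun k => by positivity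
  have hWlip : ∀ k x y, ‖W k x - W k y‖ ≤ 3 * ‖x - y‖ := fun k =>
    norm_radialCutoff_sub_le (hpos k)
  have hWle : ∀ {k x}, ‖x‖ ≤ 2 ^ k → W k x = x := fun h => radialCutoff_of_le (hpos _) h
  have hWge : ∀ {k x}, 2 ^ (k + 1) ≤ ‖x‖ → W k x = 0 := fun {k x} h =>
    radialCutoff_of_ge (hpos _) (by rwa [← pow_succ'])
  let V : ℕ → E → E := fun k x => k.casesOn (W 0 x) fun k => W (k + 1) x - W k x
  have hV0 : ∀ x, V 0 x = W 0 x := fun _ => rfl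
  have hV1 : ∀ k x, V (k + 1) x = W (k + 1) x - W k x := fun _ _ => rfl
  have hVlarge : ∀ {m k : ℕ} {x : E}, ‖x‖ ≤ 2 ^ m → m < k → V k x = 0 := fun {m k x} hx hk => by
    obtain ⟨k, rfl⟩ := Nat.exists_eq_succ_of_ne_zero (Nat.ne_zero_of_lt hk)
    have h1 : ‖x‖ ≤ 2 ^ k :=
      hx.trans (pow_le_pow_right₀ one_le_two (Nat.lt_succ_iff.1 hk))
    rw [Nat.succ_eq_add_one, hV1, hWle h1,
      hWle (h1.trans (pow_le_pow_right₀ one_le_two k.le_succ)), sub_self]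
  have hVsmall : ∀ {k : ℕ} {x : E}, 2 ^ (k + 1) ≤ ‖x‖ → V k x = 0 := fun {k x} hx => by
    cases k with
    | zero => exact hWge hx
    | succ k =>
      rw [hV1, hWge hx, hWge ((pow_le_pow_right₀ one_le_two (Nat.le_succ _)).trans hx), sub_self]
  have hsum : ∀ n x, ∑ k ∈ Finset.range (n + 1), V k x = W n x := fun n x => by
    induction n with
    | zero => simp [hV0]
    | succ n ih => rw [Finset.sum_range_succ, ih, hV1, add_sub_cancel]
  have hex : ∀ x : E, ∃ m : ℕ, ‖x‖ ≤ 2 ^ m := fun x =>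
    (pow_unbounded_of_one_lt ‖x‖ one_lt_two).imp fun _ => le_of_lt
  refine ⟨V, fun k x y => ?_, fun x => ?_, fun x => ?_, fun k => ⟨2 ^ (k + 1), fun x hx => ?_⟩⟩
  · cases k with
    | zero =>
      rw [hV0, hV0]
      linarith [hWlip 0 x y, norm_nonneg (x - y)]
    | succ k =>
      rw [hV1, hV1, sub_sub_sub_comm]
      refine (norm_sub_le_of_le (hWlip _ x y) (hWlip _ x y)).trans_eq (by ring)
  · obtain ⟨m, hm⟩ := hex x
    have h := hsum m x
    rw [hWle hm] at h
    have h2 : HasSum (fun k => V k x) (∑ k ∈ Finset.range (m + 1), V k x) :=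
      hasSum_sum_of_ne_finset_zero fun k hk =>
        hVlarge hm (by simpa [Nat.lt_succ_iff] using hk)
    rwa [h] at h2
  · classical
    have hm := Nat.find_spec (hex x)
    have hmin := fun k => Nat.find_min (hex x) (m := k)
    set m := Nat.find (hex x)
    refine ⟨{m - 1, m}, Finset.card_le_two, fun k hk => ?_⟩
    simp only [Finset.mem_insert, Finset.mem_singleton, not_or] at hk
    rcases lt_or_gt_of_ne hk.2 with h | h
    · exact hVsmall (le_of_lt (not_le.1 (hmin (k + 1) (by omega))))
    · exact hVlarge hm h
  · exact hVsmall hx.le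

/-- If norms on compact subsets of `E` are computed up to `ε` by contractions into `ℓ_p^n`, then
subsets of `E` with compact bounded parts almost bi-Lipschitzly embed into any Banach space
containing the `ℓ_p^n`'s uniformly. -/
theorem ContainsLpnUniformly.almostBiLipEmbedsInto {p : ENNReal} [Fact (1 ≤ p)]
    {Y : Type*} [NormedAddCommGroup Y] [NormedSpace ℝ Y] [CompleteSpace Y]
    (hY : ContainsLpnUniformly p Y)
    (hE : ∀ K : Set E, IsCompact K → ∀ ε : ℝ, 0 < ε →
      ∃ (n : ℕ) (P : E →L[ℝ] PiLp p fun _ : Fin n => ℝ), (∀ u, ‖P u‖ ≤ ‖u‖) ∧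
        ∀ u ∈ K, ‖u‖ - ε ≤ ‖P u‖)
    {M : Set E} (hM : ∀ R : ℝ, IsCompact (M ∩ Metric.closedBall 0 R)) :
    AlmostBiLipEmbedsInto M Y := by
  classical
  obtain ⟨lam, hlam, hT⟩ := hY.exists_almost_direct_sum
  obtain ⟨V, hVlip, hVsum, hVfin, hVbdd⟩ := exists_dyadic_decomposition E
  refine ⟨1 / 32, by norm_num, 1536 * lam, by linarith, fun φ hφ hφ0 hφ1 _ => ?_⟩
  have hδ : ∀ j : ℕ, ∃ δ : ℝ, 0 < δ ∧ δ ≤ (1 / 2) ^ j ∧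
      ∀ t, 0 ≤ t → t < δ → φ t ≤ (1 / 2) ^ (j + 1) := fun j => by
    obtain ⟨δ, hδ, h⟩ := Metric.continuousWithinAt_iff.1 (hφ 0 Set.self_mem_Ici)
      ((1 / 2) ^ (j + 1)) (by positivity)
    refine ⟨min δ ((1 / 2) ^ j), by positivity, min_le_right _ _, fun t ht0 ht => ?_⟩
    have := h (Set.mem_Ici.2 ht0) (by
      rw [Real.dist_0_eq_abs, abs_of_nonneg ht0]; exact ht.trans_le (min_le_left _ _))
    rw [hφ0, Real.dist_0_eq_abs] at this
    exact (le_abs_self _).trans this.le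
  choose δ hδ0 hδle hδφ using hδ
  have hK : ∀ k, ∃ K : Set E, IsCompact K ∧ ∀ x ∈ M, ∀ y ∈ M, V k x - V k y ∈ K := fun k => by
    obtain ⟨R, hR⟩ := hVbdd k
    have hcont : Continuous (V k) :=
      (LipschitzWith.of_dist_le_mul (K := 6) fun x y => by
        simpa [dist_eq_norm] using hVlip k x y).continuous
    have hC : IsCompact (insert 0 (V k '' (M ∩ Metric.closedBall 0 R))) :=
      ((hM R).image hcont).insert 0
    have hmem : ∀ x ∈ M, V k x ∈ insert 0 (V k '' (M ∩ Metric.closedBall 0 R)) := fun x hx => by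
      rcases le_or_gt ‖x‖ R with h | h
      · exact Or.inr ⟨x, ⟨hx, by simpa using h⟩, rfl⟩
      · exact Or.inl (hR x h)
    refine ⟨_, (hC.prod hC).image continuous_sub, fun x hx y hy =>
      ⟨(V k x, V k y), ⟨hmem x hx, hmem y hy⟩, rfl⟩⟩
  choose K hK hVK using hK
  choose N P hP hPK using fun j k => hE (K k) (hK k) (δ j / 8) (by linarith [hδ0 j])
  obtain ⟨T, hTle, hTge⟩ := hT fun n => N n.unpair.1 n.unpair.2
  let a (v : ℕ → E) (n : ℕ) : PiLp p fun _ : Fin (N n.unpair.1 n.unpair.2) => ℝ :=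
    ((1 / 2 : ℝ) ^ n.unpair.1) • P n.unpair.1 n.unpair.2 (v n.unpair.2)
  have hbound : ∀ (v : ℕ → E) (n : ℕ),
      ‖T n (a v n)‖ ≤ lam * ((1 / 2) ^ n.unpair.1 * ‖v n.unpair.2‖) := fun v n => by
    refine (hTle n _).trans ?_
    rw [norm_smul, Real.norm_of_nonneg (by positivity)]
    gcongr
    exact hP _ _ _
  have hgeom : ∀ (v : ℕ → E) (S : ℝ), HasSum (fun k => ‖v k‖) S →
      HasSum (fun n : ℕ => lam * ((1 / 2) ^ n.unpair.1 * ‖v n.unpair.2‖)) (lam * (2 * S)) :=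
    fun v S hS => by
      have h1 := HasSum.mul hasSum_geometric_two hS
        (summable_geometric_two.mul_of_nonneg hS.summable (fun _ => by positivity)
          fun _ => norm_nonneg _)
      exact ((Nat.pairEquiv.symm.hasSum_iff (f := fun q : ℕ × ℕ => (1 / 2 : ℝ) ^ q.1 * ‖v q.2‖)).2
        h1).mul_left lam
  have hfin : ∀ x, Summable fun k => ‖V k x‖ := fun x => by
    obtain ⟨s, -, hs⟩ := hVfin x
    exact summable_of_ne_finset_zero (s := s) fun k hk => by rw [hs k hk, norm_zero]
  have hf : ∀ x, HasSum (fun n => T n (a (fun k => V k x) n))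
      (∑' n, T n (a (fun k => V k x) n)) := fun x =>
    (Summable.of_norm_bounded (hgeom _ _ (hfin x).hasSum).summable
      (hbound fun k => V k x)).hasSum
  refine ⟨fun x => ∑' n, T n (a (fun k => V k x) n), fun x y => ?_⟩
  obtain ⟨x, hx⟩ := x
  obtain ⟨y, hy⟩ := y
  dsimp only
  have hfxy := (hf x).sub (hf y)
  have hsub : ∀ n, T n (a (fun k => V k x) n) - T n (a (fun k => V k y) n) =
      T n (a (fun k => V k x - V k y) n) := fun n => by
    simp only [a, map_sub, smul_sub]
  simp only [hsub] at hfxy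
  obtain ⟨s, hscard, hs⟩ : ∃ s : Finset ℕ, (s.card : ℝ) ≤ 4 ∧ ∀ k ∉ s, V k x - V k y = 0 := by
    obtain ⟨s, hs, hs0⟩ := hVfin x
    obtain ⟨t, ht, ht0⟩ := hVfin y
    refine ⟨s ∪ t, ?_, fun k hk => ?_⟩
    · exact_mod_cast (Finset.card_union_le s t).trans (add_le_add hs ht)
    · rw [Finset.mem_union, not_or] at hk
      rw [hs0 k hk.1, ht0 k hk.2, sub_zero]
  constructor
  · rcases eq_or_ne x y with rfl | hxy
    · simp
    have hpos : 0 < ‖x - y‖ := norm_pos_iff.2 (sub_ne_zero.2 hxy)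
    obtain ⟨k, hk⟩ : ∃ k, ‖x - y‖ ≤ 4 * ‖V k x - V k y‖ := by
      by_contra! hcon
      have h1 : x - y = ∑ k ∈ s, (V k x - V k y) :=
        ((hVsum x).sub (hVsum y)).unique (hasSum_sum_of_ne_finset_zero hs)
      have h2 : s.Nonempty := by
        rw [Finset.nonempty_iff_ne_empty]
        rintro rfl
        rw [h1] at hpos
        simp at hpos
      have h3 : ‖x - y‖ < ∑ k ∈ s, ‖x - y‖ / 4 := by
        calc ‖x - y‖ ≤ ∑ k ∈ s, ‖V k x - V k y‖ := by
              conv_lhs => rw [h1]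
              exact norm_sum_le _ _
          _ < ∑ k ∈ s, ‖x - y‖ / 4 :=
            Finset.sum_lt_sum_of_nonempty h2 fun k _ => by linarith [hcon k]
      rw [Finset.sum_const, nsmul_eq_mul] at h3
      nlinarith
    have hex : ∃ j, δ j ≤ ‖x - y‖ := by
      obtain ⟨j, hj⟩ := exists_pow_lt_of_lt_one hpos one_half_lt_one
      exact ⟨j, (hδle j).trans hj.le⟩
    obtain ⟨j, hj, hφj⟩ : ∃ j, δ j ≤ ‖x - y‖ ∧ φ ‖x - y‖ ≤ (1 / 2) ^ j := by
      refine ⟨Nat.find hex, Nat.find_spec hex, ?_⟩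
      rcases h : Nat.find hex with _ | j
      · simpa using (hφ1 _ hpos.le).2.le
      · exact hδφ j _ hpos.le (not_le.1 (Nat.find_min hex (by omega)))
    have h1 := hPK j k _ (hVK k x hx y hy)
    have h2 := hTge _ _ hfxy (Nat.pair j k)
    have h3 : ‖a (fun k => V k x - V k y) (Nat.pair j k)‖ =
        (1 / 2) ^ j * ‖P j k (V k x - V k y)‖ := by
      have h4 : ∀ q : ℕ × ℕ, q = (j, k) →
          ‖P q.1 q.2 (V k x - V k y)‖ = ‖P j k (V k x - V k y)‖ := by
        rintro _ rfl
        rfl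
      simp only [a, norm_smul, Nat.unpair_pair]
      rw [Real.norm_of_nonneg (by positivity), h4 _ (Nat.unpair_pair j k)]
    rw [h3] at h2
    calc φ ‖x - y‖ * (1 / 32) * ‖x - y‖ = φ ‖x - y‖ * (‖x - y‖ / 8) / 4 := by ring
      _ ≤ (1 / 2) ^ j * ‖P j k (V k x - V k y)‖ / 4 := by
        gcongr
        linarith
      _ ≤ _ := by linarith
  · have h1 : HasSum (fun k => ‖V k x - V k y‖) (∑ k ∈ s, ‖V k x - V k y‖) :=
      hasSum_sum_of_ne_finset_zero fun k hk => by rw [hs k hk, norm_zero]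
    have h2 : ∑ k ∈ s, ‖V k x - V k y‖ ≤ 4 * (6 * ‖x - y‖) := by
      refine (Finset.sum_le_card_nsmul s _ _ fun k _ => hVlip k x y).trans ?_
      rw [nsmul_eq_mul]
      gcongr
    refine (hfxy.norm_le_of_bounded (hgeom _ _ h1) (hbound fun k => V k x - V k y)).trans ?_
    calc lam * (2 * ∑ k ∈ s, ‖V k x - V k y‖) ≤ lam * (2 * (4 * (6 * ‖x - y‖))) := by gcongr
      _ = 1536 * lam * (1 / 32) * ‖x - y‖ := by ring
end

/-- **(Baudier–Lancien).** If `Y` contains the `ℓ_p^n`'s uniformly, then every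
proper subset `M` of `L_p([0,1])` almost bi-Lipschitzly embeds into `Y`. -/
theorem proper_subset_of_Lp_almost_biLipschitz_embeds
    (p : ENNReal) (hp : 1 ≤ p) [Fact (1 ≤ p)]
    (Y : Type*) [NormedAddCommGroup Y] [NormedSpace ℝ Y] [CompleteSpace Y]
    (hY : ContainsLpnUniformly p Y)
    (M : Set (Lp ℝ p (volume.restrict (Set.Icc (0 : ℝ) 1))))
    (hM : IsProperSubset M) :
    AlmostBiLipEmbedsInto M Y := by
  refine hY.almostBiLipEmbedsInto (fun K hK ε hε => hK.exists_almost_isometry_PiLp hε) fun R => ?_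
  rcases M.eq_empty_or_nonempty with rfl | ⟨x, hx⟩
  · simp
  have h := (hM x hx (R + ‖x‖)).inter_right
    (Metric.isClosed_closedBall (x := (0 : Lp ℝ p (volume.restrict (Set.Icc (0 : ℝ) 1)))) (ε := R))
  convert h using 1
  ext y
  simp only [Set.mem_inter_iff, mem_closedBall_zero_iff, Set.mem_ofPred_eq]
  refine ⟨fun hy => ⟨⟨hy.1, ?_⟩, hy.2⟩, fun hy => ⟨hy.1.1, hy.2⟩⟩
  rw [dist_eq_norm]
  exact norm_sub_le_of_le hy.2 le_rfl
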